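/- arXiv:1904.11069 — 2 statements merged into one kernel-verified Lean document; each statement's English description precedes it below -/
import Mathlib

section
/- (Ryser's interchange theorem) Let R=(R_1,…,R_m) and S=(S_1,…,S_n) be partitions of the same weight, and let A, B ∈ A(R,S). Then A can be transformed into B by a finite sequence of interchanges; i.e., there is a finite sequence of matrices A = A_0, A_1, …, A_k = B in A(R,S) such that each A_{i+1} is obtained from A_i by an interchange. -/
open Finset

/-- `A` is a `(0,1)`-matrix: every entry is `0` or `1`. -/
def IsZeroOne {m n : ℕ} (A : Matrix (Fin m) (Fin n) ℕ) : Prop :=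
  ∀ i j, A i j = 0 ∨ A i j = 1

/-- The class `𝒜(R,S)` of `(0,1)`-matrices with row sum vector `R` and
column sum vector `S`. -/
def ARS {m n : ℕ} (R : Fin m → ℕ) (S : Fin n → ℕ) :
    Set (Matrix (Fin m) (Fin n) ℕ) :=
  {A | IsZeroOne A ∧ (∀ i, ∑ j, A i j = R i) ∧ (∀ j, ∑ i, A i j = S j)}

/-- `R` and `S` are partitions of the same weight. -/
def IsPartitionPair {m n : ℕ} (R : Fin m → ℕ) (S : Fin n → ℕ) : Prop :=
  Antitone R ∧ (∀ i, 0 < R i) ∧ Antitone S ∧ (∀ j, 0 < S j) ∧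
    ∑ i, R i = ∑ j, S j

/-- The rows `E` and the columns `F` cover all the `1`'s of `A`. -/
def Covers {m n : ℕ} (A : Matrix (Fin m) (Fin n) ℕ)
    (E : Finset (Fin m)) (F : Finset (Fin n)) : Prop :=
  ∀ i j, A i j = 1 → i ∈ E ∨ j ∈ F

/-- The `t`-term rank of `A`: the maximum number of `1`'s of `A` with at most
one `1` in each column and at most `t` `1`'s in each row. -/
def tTermRank {m n : ℕ} (t : ℕ) (A : Matrix (Fin m) (Fin n) ℕ) : ℕ :=
  Finset.sup ((Finset.univ : Finset (Fin m × Fin n)).powerset.filter fun P =>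
      (∀ p ∈ P, A p.1 p.2 = 1) ∧
      (∀ j : Fin n, (P.filter fun p => p.2 = j).card ≤ 1) ∧
      (∀ i : Fin m, (P.filter fun p => p.1 = i).card ≤ t))
    Finset.card

/-- The minimum `t`-term rank over the class `𝒜(R,S)`. -/
noncomputable def minTermRank {m n : ℕ} (t : ℕ) (R : Fin m → ℕ)
    (S : Fin n → ℕ) : ℕ :=
  sInf {r : ℕ | ∃ A ∈ ARS R S, tTermRank t A = r}

/-- The structure matrix `t_{k,l}` associated with `R` and `S`
(`R`, `S` being 1-indexed in the paper, here 0-indexed):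
`t_{k,l} = k·l − ∑_{j=1}^{l} S_j + ∑_{i=k+1}^{m} R_i`. -/
def structMat {m n : ℕ} (R : Fin m → ℕ) (S : Fin n → ℕ) (k l : ℕ) : ℤ :=
  (k : ℤ) * l - ∑ j ∈ Finset.univ.filter (fun j : Fin n => (j : ℕ) < l), (S j : ℤ)
    + ∑ i ∈ Finset.univ.filter (fun i : Fin m => k ≤ (i : ℕ)), (R i : ℤ)

/-- `φ_{k,l} = min { t_{i1,l+j2} + t_{k+i2,j1} + (k−i1)(l−j1) }` over all
`0 ≤ i1 ≤ k ≤ k+i2 ≤ m` and `0 ≤ j1 ≤ l ≤ l+j2 ≤ n`. -/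
noncomputable def phi {m n : ℕ} (R : Fin m → ℕ) (S : Fin n → ℕ) (k l : ℕ) : ℤ :=
  sInf {v : ℤ | ∃ i1 i2 j1 j2 : ℕ,
    i1 ≤ k ∧ k + i2 ≤ m ∧ j1 ≤ l ∧ l + j2 ≤ n ∧
    v = structMat R S i1 (l + j2) + structMat R S (k + i2) j1
        + ((k : ℤ) - i1) * ((l : ℤ) - j1)}

/-- `ψ_{a,b;c,d}` as in the paper, the minimum being taken over all
`0 ≤ i1 ≤ a ≤ a+i2 ≤ b ≤ b+i3 ≤ m` and `0 ≤ j1 ≤ c ≤ c+j2 ≤ d ≤ d+j3 ≤ n`. -/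
noncomputable def psi {m n : ℕ} (R : Fin m → ℕ) (S : Fin n → ℕ)
    (a b c d : ℕ) : ℤ :=
  sInf {v : ℤ | ∃ i1 i2 i3 j1 j2 j3 : ℕ,
    i1 ≤ a ∧ a + i2 ≤ b ∧ b + i3 ≤ m ∧
    j1 ≤ c ∧ c + j2 ≤ d ∧ d + j3 ≤ n ∧
    v = structMat R S i1 (d + j3) + structMat R S (a + i2) (c + j2)
        + structMat R S (b + i3) j1
        + ((a : ℤ) - i1) * ((d : ℤ) - (c : ℤ) - j2)
        + ((b : ℤ) - (a : ℤ) - i2) * ((c : ℤ) - j1)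
        + ((a : ℤ) - i1) * ((c : ℤ) - j1)}

/-- `B` is obtained from `A` by an interchange: a `2×2` submatrix equal to
`[[1,0],[0,1]]` is replaced by `[[0,1],[1,0]]` (or vice versa), all other
entries being left unchanged. -/
def Interchange {m n : ℕ} (A B : Matrix (Fin m) (Fin n) ℕ) : Prop :=
  ∃ (i₁ i₂ : Fin m) (j₁ j₂ : Fin n), i₁ ≠ i₂ ∧ j₁ ≠ j₂ ∧
    ((A i₁ j₁ = 1 ∧ A i₁ j₂ = 0 ∧ A i₂ j₁ = 0 ∧ A i₂ j₂ = 1 ∧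
      B i₁ j₁ = 0 ∧ B i₁ j₂ = 1 ∧ B i₂ j₁ = 1 ∧ B i₂ j₂ = 0) ∨
     (A i₁ j₁ = 0 ∧ A i₁ j₂ = 1 ∧ A i₂ j₁ = 1 ∧ A i₂ j₂ = 0 ∧
      B i₁ j₁ = 1 ∧ B i₁ j₂ = 0 ∧ B i₂ j₁ = 0 ∧ B i₂ j₂ = 1)) ∧
    ∀ i j, ¬((i = i₁ ∨ i = i₂) ∧ (j = j₁ ∨ j = j₂)) → B i j = A i j

/-- The relation of being related by an interchange inside `𝒜(R,S)`. -/
def InterchangeIn {m n : ℕ} (R : Fin m → ℕ) (S : Fin n → ℕ)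
    (X Y : Matrix (Fin m) (Fin n) ℕ) : Prop :=
  X ∈ ARS R S ∧ Y ∈ ARS R S ∧ Interchange X Y

theorem Interchange.symm {m n : ℕ} {A B : Matrix (Fin m) (Fin n) ℕ}
    (h : Interchange A B) : Interchange B A := by
  obtain ⟨i, k, p, q, hik, hpq, h, h'⟩ := h
  exact ⟨i, k, p, q, hik, hpq, by tauto, fun a b hab => (h' a b hab).symm⟩

theorem InterchangeIn.symm {m n : ℕ} {R : Fin m → ℕ} {S : Fin n → ℕ}
    {A B : Matrix (Fin m) (Fin n) ℕ} (h : InterchangeIn R S A B) : InterchangeIn R S B A :=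
  ⟨h.2.1, h.1, h.2.2.symm⟩

/-- The positions in which `A` and `B` differ. -/
def diffPos {m n : ℕ} (A B : Matrix (Fin m) (Fin n) ℕ) : Finset (Fin m × Fin n) :=
  univ.filter fun x => A x.1 x.2 ≠ B x.1 x.2

theorem diffPos_comm {m n : ℕ} (A B : Matrix (Fin m) (Fin n) ℕ) :
    diffPos A B = diffPos B A := by
  simp only [diffPos, ne_comm]

/-- Exchange the entries in columns `p` and `q` within each of the rows `i` and `k`. -/
def switch {m n : ℕ} (A : Matrix (Fin m) (Fin n) ℕ) (i k : Fin m) (p q : Fin n) :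
    Matrix (Fin m) (Fin n) ℕ :=
  fun a b => if a = i ∨ a = k then A a (Equiv.swap p q b) else A a b

section Switch

variable {m n : ℕ} {R : Fin m → ℕ} {S : Fin n → ℕ} {A : Matrix (Fin m) (Fin n) ℕ}
  {i k : Fin m} {p q : Fin n}

theorem switch_of_not_mem {a : Fin m} {b : Fin n}
    (h : ¬((a = i ∨ a = k) ∧ (b = p ∨ b = q))) : switch A i k p q a b = A a b := by
  unfold switch
  split_ifs with ha
  · rw [Equiv.swap_apply_of_ne_of_ne] <;> tauto
  · rfl

theorem switch_eq_swap_rows (hip : A i p = 1) (hiq : A i q = 0) (hkp : A k p = 0)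
    (hkq : A k q = 1) (a : Fin m) (b : Fin n) :
    switch A i k p q a b = if b = p ∨ b = q then A (Equiv.swap i k a) b else A a b := by
  unfold switch
  simp only [Equiv.swap_apply_def]
  grind

theorem switch_mem_ARS (hA : A ∈ ARS R S) (hip : A i p = 1) (hiq : A i q = 0)
    (hkp : A k p = 0) (hkq : A k q = 1) : switch A i k p q ∈ ARS R S := by
  refine ⟨fun a b => ?_, fun a => ?_, fun b => ?_⟩
  · unfold switch
    split_ifs
    · exact hA.1 _ _
    · exact hA.1 _ _
  · rw [← hA.2.1 a]
    unfold switch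
    split_ifs
    · exact Equiv.sum_comp (Equiv.swap p q) (A a)
    · rfl
  · rw [← hA.2.2 b]
    simp only [switch_eq_swap_rows hip hiq hkp hkq]
    split_ifs
    · exact Equiv.sum_comp (Equiv.swap i k) fun a => A a b
    · rfl

theorem interchangeIn_switch (hA : A ∈ ARS R S) (hip : A i p = 1) (hiq : A i q = 0)
    (hkp : A k p = 0) (hkq : A k q = 1) : InterchangeIn R S A (switch A i k p q) := by
  refine ⟨hA, switch_mem_ARS hA hip hiq hkp hkq, i, k, p, q, ?_, ?_,
    Or.inl ⟨hip, hiq, hkp, hkq, ?_⟩, fun a b h => switch_of_not_mem h⟩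
  · rintro rfl
    omega
  · rintro rfl
    omega
  · simp [switch, *]

theorem card_diffPos_switch_lt {B : Matrix (Fin m) (Fin n) ℕ} (hB : IsZeroOne B)
    (hip : A i p = 1) (hiq : A i q = 0) (hkp : A k p = 0) (hkq : A k q = 1)
    (hip' : B i p = 0) (hiq' : B i q = 1) (hk : ¬(B k p = 0 ∧ B k q = 1)) :
    (diffPos (switch A i k p q) B).card < (diffPos A B).card := by
  have hpq : p ≠ q := by
    rintro rfl
    omega
  have hsub : ∃ x, diffPos (switch A i k p q) B ⊆
      insert x (((diffPos A B).erase (i, p)).erase (i, q)) := by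
    refine ⟨if B k p = 0 then (k, p) else (k, q), ?_⟩
    rintro ⟨a, b⟩ hab
    have hBp := hB k p
    have hBq := hB k q
    by_cases h : (a = i ∨ a = k) ∧ (b = p ∨ b = q)
    · have hne : switch A i k p q a b ≠ B a b := by simpa [diffPos] using hab
      obtain ⟨rfl | rfl, rfl | rfl⟩ := h <;> simp [switch, *] at hne ⊢ <;> grind
    · have hne : A a b ≠ B a b := by
        rw [← switch_of_not_mem (A := A) h]
        simpa [diffPos] using hab
      refine mem_insert_of_mem (mem_erase.2 ⟨?_, mem_erase.2 ⟨?_, by simpa [diffPos] using hne⟩⟩)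
      · grind
      · grind
  obtain ⟨x, hx⟩ := hsub
  have hp : (i, p) ∈ diffPos A B := by simp [diffPos, hip, hip']
  have hq : (i, q) ∈ (diffPos A B).erase (i, p) := by simp [diffPos, hiq, hiq', hpq.symm]
  have h₁ := card_le_card hx
  have h₂ := card_insert_le x (((diffPos A B).erase (i, p)).erase (i, q))
  have h₃ := card_erase_add_one hq
  have h₄ := card_erase_add_one hp
  omega

end Switch

theorem exists_gt_of_sum_eq_of_ne {ι : Type*} [Fintype ι] {f g : ι → ℕ}
    (h : ∑ x, f x = ∑ x, g x) (hne : f ≠ g) : ∃ x, g x < f x := by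
  by_contra! hle
  exact hne (funext fun x => (sum_eq_sum_iff_of_le fun x _ => hle x).1 h x (mem_univ x))

/-- If row `i` of `A` has the pattern `1 0` in columns `p, q`, and row `i` of `B` the pattern
`0 1`, then equality of column sums forces a compensating row `k`. -/
theorem exists_compensating_row {m n : ℕ} {A B : Matrix (Fin m) (Fin n) ℕ} {i : Fin m}
    {p q : Fin n} (hp : ∑ a, A a p = ∑ a, B a p) (hq : ∑ a, A a q = ∑ a, B a q)
    (hip : B i p < A i p) (hiq : A i q < B i q) :
    ∃ k, A k p + B k q < A k q + B k p := by
  obtain ⟨k, hk⟩ := exists_gt_of_sum_eq_of_ne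
    (f := fun a => A a q + B a p) (g := fun a => A a p + B a q)
    (by simp only [sum_add_distrib]; omega)
    (fun h => by
      have : A i q + B i p = A i p + B i q := congrFun h i
      omega)
  exact ⟨k, hk⟩

/-- Two distinct matrices of `𝒜(R,S)` can be brought closer by an interchange in one of them. -/
theorem exists_interchangeIn_card_diffPos_lt {m n : ℕ} {R : Fin m → ℕ} {S : Fin n → ℕ}
    {A B : Matrix (Fin m) (Fin n) ℕ} (hA : A ∈ ARS R S) (hB : B ∈ ARS R S) (hne : A ≠ B) :
    (∃ A', InterchangeIn R S A A' ∧ (diffPos A' B).card < (diffPos A B).card) ∨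
      ∃ B', InterchangeIn R S B B' ∧ (diffPos A B').card < (diffPos A B).card := by
  obtain ⟨i, hi⟩ := Function.ne_iff.1 hne
  have hrow : ∑ j, A i j = ∑ j, B i j := (hA.2.1 i).trans (hB.2.1 i).symm
  have hcol (j) : ∑ a, A a j = ∑ a, B a j := (hA.2.2 j).trans (hB.2.2 j).symm
  obtain ⟨p, hp⟩ := exists_gt_of_sum_eq_of_ne hrow hi
  obtain ⟨q, hq⟩ := exists_gt_of_sum_eq_of_ne hrow.symm (Ne.symm hi)
  obtain ⟨k, hk⟩ := exists_compensating_row (hcol p) (hcol q) hp hq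
  have := hA.1 i p
  have := hA.1 i q
  have := hA.1 k p
  have := hA.1 k q
  have := hB.1 i p
  have := hB.1 i q
  have := hB.1 k p
  have := hB.1 k q
  by_cases h : A k p = 0 ∧ A k q = 1
  · left
    exact ⟨switch A i k p q, interchangeIn_switch hA (by omega) (by omega) h.1 h.2,
      card_diffPos_switch_lt hB.1 (by omega) (by omega) h.1 h.2 (by omega) (by omega) (by omega)⟩
  · right
    refine ⟨switch B i k q p,
      interchangeIn_switch hB (by omega) (by omega) (by omega) (by omega), ?_⟩
    rw [diffPos_comm A, diffPos_comm A]
    exact card_diffPos_switch_lt hA.1 (by omega) (by omega) (by omega) (by omega) (by omega)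
      (by omega) (by omega)

/-- Ryser's interchange theorem: any two matrices in `𝒜(R,S)` are connected by
a finite sequence of interchanges staying inside `𝒜(R,S)`. -/
theorem ryser_interchange {m n : ℕ} (R : Fin m → ℕ) (S : Fin n → ℕ)
    (hRS : IsPartitionPair R S) (A B : Matrix (Fin m) (Fin n) ℕ)
    (hA : A ∈ ARS R S) (hB : B ∈ ARS R S) :
    Relation.ReflTransGen
      (fun X Y => X ∈ ARS R S ∧ Y ∈ ARS R S ∧ Interchange X Y) A B := by
  change Relation.ReflTransGen (InterchangeIn R S) A B
  induction hd : (diffPos A B).card using Nat.strong_induction_on generalizing A B with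
  | _ d ih =>
    subst hd
    by_cases hne : A = B
    · rw [hne]
    · obtain ⟨A', hA', hlt⟩ | ⟨B', hB', hlt⟩ := exists_interchangeIn_card_diffPos_lt hA hB hne
      · exact (ih _ hlt A' B hA'.2.1 hB rfl).head hA'
      · exact (ih _ hlt A B' hA hB'.2.1 rfl).tail hB'.symm
end

section
/- Let R=(R_1,…,R_m) and S=(S_1,…,S_n) be partitions of the same weight such that A(R,S) is nonempty. Then there exists a single matrix A ∈ A(R,S) such that ρ_t(A) = max{ρ_t(B) : B ∈ A(R,S)} for every positive integer t; i.e., some matrix in the class simultaneously realizes all the maximum t-term ranks. -/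
open Finset

/-- The integer matrix `C` has all its entries in `{0, 1}`. -/
def IsBinary {α β : Type*} (C : α → β → ℤ) : Prop :=
  ∀ i j, C i j = 0 ∨ C i j = 1

/-- The difference `e_i - e_p` of two unit vectors. -/
def unitDiff {α : Type*} [DecidableEq α] (i p a : α) : ℤ :=
  (if a = i then 1 else 0) - if a = p then 1 else 0

theorem IsBinary.add_interchange {α β : Type*} [DecidableEq α] [DecidableEq β]
    {C : α → β → ℤ} (hC : IsBinary C) {i p : α} {j l : β}
    (hip : i ≠ p) (hjl : j ≠ l) (h1 : C i j = 0) (h2 : C i l = 1) (h3 : C p j = 1)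
    (h4 : C p l = 0) : IsBinary fun a b => C a b + unitDiff i p a * unitDiff j l b := by
  intro a b
  have := hC a b
  unfold unitDiff
  grind

theorem IsBinary.add_move {α β : Type*} [DecidableEq α] [DecidableEq β]
    {C : α → β → ℤ} (hC : IsBinary C) {i p : α} {j : β}
    (h1 : C i j = 0) (h2 : C p j = 1) :
    IsBinary fun a b => C a b + unitDiff i p a * if b = j then 1 else 0 := by
  intro a b
  have := hC a b
  unfold unitDiff
  grind

/-- Effect on the slack `R - C` of moving a `1` of `C` within column `j` from row `p` to row `i`. -/
theorem slack_move {α β : Type*} [Fintype β] [DecidableEq α] [DecidableEq β] (R r : α → ℤ)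
    (C : α → β → ℤ) (i p : α) (j : β) (hr : ∀ a, r a = R a - ∑ b, C a b) (a : α) :
    R a - ∑ b, (C a b + unitDiff i p a * if b = j then 1 else 0) = r a - unitDiff i p a := by
  simp [Finset.sum_add_distrib, hr]
  ring

section

variable {α β : Type*} [Fintype α] [Fintype β] [DecidableEq α] [DecidableEq β]

theorem sum_unitDiff_mul (i p : α) (f : α → ℤ) :
    ∑ a, unitDiff i p a * f a = f i - f p := by
  simp [unitDiff, sub_mul, Finset.sum_sub_distrib]

theorem sum_unitDiff (i p : α) : ∑ a, unitDiff i p a = 0 := by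
  simpa using sum_unitDiff_mul i p (fun _ => 1)

/-- A nonnegative integer function attains its minimum on a nonempty set. -/
theorem exists_minimizer {X : Type*} (p : X → Prop) (f : X → ℤ) (hf : ∀ x, p x → 0 ≤ f x)
    (h : ∃ x, p x) : ∃ x, p x ∧ ∀ y, p y → f x ≤ f y := by
  obtain ⟨x, hx, hmin⟩ := (measure fun x => (f x).toNat).wf.has_min {x | p x} h
  refine ⟨x, hx, fun y hy => ?_⟩
  have h1 : ¬ (f y).toNat < (f x).toNat := hmin y hy
  have h2 := hf x hx
  have h3 := hf y hy
  omega

theorem sum_sum_interchange_mul (i p : α) (j l : β) (M : α → β → ℤ) :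
    ∑ a, ∑ b, unitDiff i p a * unitDiff j l b * M a b = M i j - M i l - (M p j - M p l) := by
  simp only [mul_assoc, ← Finset.mul_sum, sum_unitDiff_mul]

/-- If `A` and `C` are binary matrices whose difference has nonnegative row sums and all column
sums equal to `1`, then both can be rearranged, preserving row and column sums, so that
`C ≤ A` entrywise. -/
theorem exists_nested_of_sub_colSum_eq_one (A C : α → β → ℤ) (hA : IsBinary A) (hC : IsBinary C)
    (hcol : ∀ j, ∑ i, A i j - ∑ i, C i j = 1) (hrow : ∀ i, ∑ j, C i j ≤ ∑ j, A i j) :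
    ∃ A' C' : α → β → ℤ, IsBinary A' ∧ IsBinary C' ∧
      (∀ i, ∑ j, A' i j = ∑ j, A i j) ∧ (∀ j, ∑ i, A' i j = ∑ i, A i j) ∧
      (∀ i, ∑ j, C' i j = ∑ j, C i j) ∧ (∀ j, ∑ i, C' i j = ∑ i, C i j) ∧
      ∀ i j, C' i j ≤ A' i j := by
  obtain ⟨⟨A', C'⟩, ⟨hA', hC', hAr, hAc, hCr, hCc⟩, hmin⟩ := exists_minimizer
    (fun x : (α → β → ℤ) × (α → β → ℤ) => IsBinary x.1 ∧ IsBinary x.2 ∧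
      (∀ i, ∑ j, x.1 i j = ∑ j, A i j) ∧ (∀ j, ∑ i, x.1 i j = ∑ i, A i j) ∧
      (∀ i, ∑ j, x.2 i j = ∑ j, C i j) ∧ (∀ j, ∑ i, x.2 i j = ∑ i, C i j))
    (fun x => ∑ i, ∑ j, x.2 i j * (1 - x.1 i j))
    (fun x hx => Finset.sum_nonneg fun i _ => Finset.sum_nonneg fun j _ => by
      rcases hx.1 i j with h | h <;> rcases hx.2.1 i j with h' | h' <;> simp [h, h'])
    ⟨(A, C), hA, hC, by simp⟩
  refine ⟨A', C', hA', hC', hAr, hAc, hCr, hCc, ?_⟩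
  dsimp only at hA' hC' hAr hAc hCr hCc hmin
  by_contra! hlt
  obtain ⟨i, j, hij⟩ := hlt
  have hAij : A' i j = 0 := by have := hA' i j; have := hC' i j; omega
  have hCij : C' i j = 1 := by have := hA' i j; have := hC' i j; omega
  obtain ⟨l, hl⟩ : ∃ l, C' i l < A' i l := by
    by_contra! hle
    have h1 := Finset.sum_lt_sum (fun b (_ : b ∈ Finset.univ) => hle b)
      ⟨j, Finset.mem_univ j, hij⟩
    have h2 := hrow i
    rw [← hAr, ← hCr] at h2
    omega
  have hAil : A' i l = 1 := by have := hA' i l; have := hC' i l; omega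
  have hCil : C' i l = 0 := by have := hA' i l; have := hC' i l; omega
  have hjl : j ≠ l := by rintro rfl; omega
  obtain ⟨p, hpi, hp⟩ : ∃ p, p ≠ i ∧ A' p l - C' p l < A' p j - C' p j := by
    by_contra! hle
    have h1 : ∑ a ∈ Finset.univ.erase i, (A' a j - C' a j)
        ≤ ∑ a ∈ Finset.univ.erase i, (A' a l - C' a l) :=
      Finset.sum_le_sum fun a ha => hle a (Finset.ne_of_mem_erase ha)
    have h2 : ∀ b, ∑ a ∈ Finset.univ.erase i, (A' a b - C' a b) = 1 - (A' i b - C' i b) := by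
      intro b
      have h3 := Finset.add_sum_erase Finset.univ (fun a => A' a b - C' a b) (Finset.mem_univ i)
      have h4 := hcol b
      rw [← hAc, ← hCc, ← Finset.sum_sub_distrib] at h4
      omega
    rw [h2, h2] at h1
    omega
  have hAp := hA' p j
  have hAp' := hA' p l
  have hCp := hC' p j
  have hCp' := hC' p l
  by_cases hcase : A' p j = 1 ∧ A' p l = 0
  · have := hmin (fun a b => A' a b + unitDiff i p a * unitDiff j l b, C')
      ⟨hA'.add_interchange hpi.symm hjl hAij hAil hcase.1 hcase.2, hC',
        fun a => by simp [Finset.sum_add_distrib, ← Finset.mul_sum, sum_unitDiff, hAr],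
        fun b => by simp [Finset.sum_add_distrib, ← Finset.sum_mul, sum_unitDiff, hAc],
        hCr, hCc⟩
    have hE := sum_sum_interchange_mul i p j l C'
    have : ∑ a, ∑ b, C' a b * (1 - (A' a b + unitDiff i p a * unitDiff j l b))
        = ∑ a, ∑ b, C' a b * (1 - A' a b) -
          ∑ a, ∑ b, unitDiff i p a * unitDiff j l b * C' a b := by
      simp only [← Finset.sum_sub_distrib]
      congr! 2
      ring
    dsimp only at *
    omega
  · have hcase' : C' p j = 0 ∧ C' p l = 1 := by omega
    have := hmin (A', fun a b => C' a b + unitDiff p i a * unitDiff j l b)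
      ⟨hA', hC'.add_interchange hpi hjl hcase'.1 hcase'.2 hCij hCil, hAr, hAc,
        fun a => by simp [Finset.sum_add_distrib, ← Finset.mul_sum, sum_unitDiff, hCr],
        fun b => by simp [Finset.sum_add_distrib, ← Finset.sum_mul, sum_unitDiff, hCc]⟩
    have hE := sum_sum_interchange_mul p i j l (fun a b => 1 - A' a b)
    have : ∑ a, ∑ b, (C' a b + unitDiff p i a * unitDiff j l b) * (1 - A' a b)
        = ∑ a, ∑ b, C' a b * (1 - A' a b) +
          ∑ a, ∑ b, unitDiff p i a * unitDiff j l b * (1 - A' a b) := by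
      simp only [← Finset.sum_add_distrib]
      congr! 2
      ring
    dsimp only at *
    omega

theorem sum_sq_sub_unitDiff (r : α → ℤ) {i p : α} (hip : i ≠ p) :
    ∑ a, (r a - unitDiff i p a) ^ 2 = ∑ a, r a ^ 2 - 2 * (r i - r p - 1) := by
  have h := sum_unitDiff_mul i p (fun a => 2 * r a - unitDiff i p a)
  have hi : unitDiff i p i = 1 := by simp [unitDiff, hip]
  have hp : unitDiff i p p = -1 := by simp [unitDiff, hip.symm]
  rw [hi, hp] at h
  have : ∑ a, (r a - unitDiff i p a) ^ 2
      = ∑ a, r a ^ 2 - ∑ a, unitDiff i p a * (2 * r a - unitDiff i p a) := by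
    rw [← Finset.sum_sub_distrib]
    congr! 1
    ring
  rw [this, h]
  ring

theorem sum_comp_sub_unitDiff (r : α → ℤ) {i p : α} (h : r i = r p + 1) (g : ℤ → ℤ) :
    ∑ a, g (r a - unitDiff i p a) = ∑ a, g (r a) := by
  rw [← Equiv.sum_comp (Equiv.swap i p) (fun a => g (r a))]
  refine Finset.sum_congr rfl fun a _ => congrArg g ?_
  rw [Equiv.swap_apply_def]
  unfold unitDiff
  grind

/-- Among the binary matrices with column sums `T` and row sums at most `R`, there is one whose
slack vector maximizes all the sums `∑ min (slack, t)` simultaneously. -/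
theorem exists_slack_maximizing_all_truncated_sums (R : α → ℤ) (T : β → ℤ)
    (hne : ∃ C : α → β → ℤ, IsBinary C ∧ (∀ j, ∑ i, C i j = T j) ∧ ∀ i, ∑ j, C i j ≤ R i) :
    ∃ C : α → β → ℤ, (IsBinary C ∧ (∀ j, ∑ i, C i j = T j) ∧ ∀ i, ∑ j, C i j ≤ R i) ∧
      ∀ D : α → β → ℤ, IsBinary D → (∀ j, ∑ i, D i j = T j) → ∀ t : ℤ,
        ∑ i, min (R i - ∑ j, D i j) t ≤ ∑ i, min (R i - ∑ j, C i j) t := by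
  obtain ⟨C₀, hC₀, hmin⟩ := exists_minimizer _
    (fun C : α → β → ℤ => ∑ i, (R i - ∑ j, C i j) ^ 2)
    (fun _ _ => Finset.sum_nonneg fun _ _ => sq_nonneg _) hne
  refine ⟨C₀, hC₀, fun D hD hDT t => ?_⟩
  obtain ⟨C, ⟨⟨hC, hCT, hCR⟩, hsq, ht⟩, hclose⟩ := exists_minimizer
    (fun C : α → β → ℤ =>
      (IsBinary C ∧ (∀ j, ∑ i, C i j = T j) ∧ ∀ i, ∑ j, C i j ≤ R i) ∧
      ∑ i, (R i - ∑ j, C i j) ^ 2 = ∑ i, (R i - ∑ j, C₀ i j) ^ 2 ∧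
      ∑ i, min (R i - ∑ j, C i j) t = ∑ i, min (R i - ∑ j, C₀ i j) t)
    (fun C => ∑ i, ∑ j, C i j * (1 - D i j))
    (fun C hC => Finset.sum_nonneg fun i _ => Finset.sum_nonneg fun j _ => by
      rcases hC.1.1 i j with h | h <;> rcases hD i j with h' | h' <;> simp [h, h'])
    ⟨C₀, hC₀, rfl, rfl⟩
  rw [← ht]
  obtain ⟨r, hr⟩ : ∃ r : α → ℤ, ∀ a, r a = R a - ∑ b, C a b := ⟨_, fun _ => rfl⟩
  have key : ∀ i p j, C i j = 0 → D i j = 1 → C p j = 1 → D p j = 0 → r i ≤ r p := by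
    intro i p j hCi hDi hCp hDp
    by_contra! hlt
    have hip : i ≠ p := by rintro rfl; omega
    have hfeas : IsBinary (fun a b => C a b + unitDiff i p a * if b = j then 1 else 0) ∧
        (∀ b, ∑ a, (C a b + unitDiff i p a * if b = j then 1 else 0) = T b) ∧
        ∀ a, ∑ b, (C a b + unitDiff i p a * if b = j then 1 else 0) ≤ R a := by
      refine ⟨hC.add_move hCi hCp, fun b => ?_, fun a => ?_⟩
      · rw [Finset.sum_add_distrib, ← Finset.sum_mul, sum_unitDiff, zero_mul, add_zero, hCT]
      · have h1 := slack_move R r C i p j hr a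
        have h2 := hr a
        have h3 := hCR a
        have h4 := hr p
        have h5 := hCR p
        have h6 : unitDiff i p a ≤ r a := by
          unfold unitDiff
          split_ifs with h7 h8 h8 <;> subst_vars <;> omega
        linarith
    have hsq' := hmin _ hfeas
    simp only [slack_move R r C i p j hr, sum_sq_sub_unitDiff r hip, ← hsq, ← hr] at hsq'
    have heq : r i = r p + 1 := by omega
    have hcl := hclose _ ⟨hfeas, by
        simp only [slack_move R r C i p j hr, sum_sq_sub_unitDiff r hip, ← hsq, ← hr]
        rw [heq]; ring, by
        simp only [slack_move R r C i p j hr, ← ht, ← hr]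
        exact sum_comp_sub_unitDiff r heq (fun x => min x t)⟩
    have hE : ∑ a, ∑ b, (C a b + unitDiff i p a * if b = j then 1 else 0) * (1 - D a b)
        = ∑ a, ∑ b, C a b * (1 - D a b) + ∑ a, unitDiff i p a * (1 - D a j) := by
      rw [← Finset.sum_add_distrib]
      refine Finset.sum_congr rfl fun a _ => ?_
      simp [add_mul, Finset.sum_add_distrib]
    rw [sum_unitDiff_mul] at hE
    omega
  have hH : ∀ j, ∑ i with t < r i, D i j ≤ ∑ i with t < r i, C i j := by
    intro j
    by_cases hx : ∃ i, t < r i ∧ C i j = 0 ∧ D i j = 1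
    · obtain ⟨i, hi, hCi, hDi⟩ := hx
      have h1 : ∑ a with ¬ t < r a, C a j ≤ ∑ a with ¬ t < r a, D a j := by
        refine Finset.sum_le_sum fun a ha => ?_
        have h2 := (Finset.mem_filter.1 ha).2
        have h3 := key i a j hCi hDi
        have h4 := hC a j
        have h5 := hD a j
        omega
      have h6 := Finset.sum_filter_add_sum_filter_not Finset.univ (fun a => t < r a)
        (fun a => C a j)
      have h7 := Finset.sum_filter_add_sum_filter_not Finset.univ (fun a => t < r a)
        (fun a => D a j)
      have h8 := hCT j
      have h9 := hDT j
      omega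
    · push Not at hx
      refine Finset.sum_le_sum fun a ha => ?_
      have h2 := hx a (Finset.mem_filter.1 ha).2
      have h4 := hC a j
      have h5 := hD a j
      omega
  have hH' : ∑ i with t < r i, ∑ j, D i j ≤ ∑ i with t < r i, ∑ j, C i j := by
    rw [Finset.sum_comm, Finset.sum_comm (s := Finset.univ.filter _)]
    exact Finset.sum_le_sum fun j _ => hH j
  have htot : ∑ i, ∑ j, D i j = ∑ i, ∑ j, C i j := by
    rw [Finset.sum_comm, Finset.sum_comm (f := C)]
    simp only [hCT, hDT]
  have hDsplit := Finset.sum_filter_add_sum_filter_not Finset.univ (fun a => t < r a)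
    (fun a => ∑ j, D a j)
  have hCsplit := Finset.sum_filter_add_sum_filter_not Finset.univ (fun a => t < r a)
    (fun a => ∑ j, C a j)
  rw [← Finset.sum_filter_add_sum_filter_not Finset.univ (fun a => t < r a),
    ← Finset.sum_filter_add_sum_filter_not (s := Finset.univ) (fun a => t < r a)
      (f := fun a => min (R a - ∑ j, C a j) t)]
  refine add_le_add (Finset.sum_le_sum fun a ha => ?_) ?_
  · have h1 := (Finset.mem_filter.1 ha).2
    rw [hr] at h1
    omega
  · calc ∑ a with ¬ t < r a, min (R a - ∑ j, D a j) t
        ≤ ∑ a with ¬ t < r a, (R a - ∑ j, D a j) :=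
          Finset.sum_le_sum fun a _ => min_le_left _ _
      _ ≤ ∑ a with ¬ t < r a, (R a - ∑ j, C a j) := by
          rw [Finset.sum_sub_distrib, Finset.sum_sub_distrib]
          omega
      _ = ∑ a with ¬ t < r a, min (R a - ∑ j, C a j) t := by
          refine Finset.sum_congr rfl fun a ha => ?_
          have h1 := (Finset.mem_filter.1 ha).2
          rw [hr] at h1
          omega

end

/-- A choice of ones with at most one per column extends, when no column of `B` vanishes, to a
choice of exactly one in every column. -/
theorem exists_column_choice {m n : ℕ} {B : Matrix (Fin m) (Fin n) ℕ} {P : Finset (Fin m × Fin n)}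
    (hB : ∀ j, ∃ i, B i j = 1) (h1 : ∀ p ∈ P, B p.1 p.2 = 1)
    (h2 : ∀ j : Fin n, (P.filter fun p => p.2 = j).card ≤ 1) :
    ∃ c : Fin n → Fin m, (∀ j, B (c j) j = 1) ∧ ∀ p ∈ P, c p.2 = p.1 := by
  have : ∀ j, ∃ i, B i j = 1 ∧ ∀ p ∈ P, p.2 = j → i = p.1 := by
    intro j
    by_cases hx : ∃ p ∈ P, p.2 = j
    · obtain ⟨p, hp, rfl⟩ := hx
      refine ⟨p.1, h1 p hp, fun q hq hqp => ?_⟩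
      rw [Finset.card_le_one.1 (h2 p.2) p (by simp [hp]) q (by simp [hq, hqp])]
    · push Not at hx
      obtain ⟨i, hi⟩ := hB j
      exact ⟨i, hi, fun p hp hpj => absurd hpj (hx p hp)⟩
  choose c hc hc' using this
  exact ⟨c, hc, fun p hp => hc' _ p hp rfl⟩

/-- Deleting from a matrix of `𝒜(R,S)` a chosen one in each column. -/
theorem isBinary_sub_column_choice {m n : ℕ} {R : Fin m → ℕ} {S : Fin n → ℕ}
    {B : Matrix (Fin m) (Fin n) ℕ} (hB : B ∈ ARS R S) {c : Fin n → Fin m}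
    (hc : ∀ j, B (c j) j = 1) :
    IsBinary (fun i j => (B i j : ℤ) - if c j = i then 1 else 0) ∧
      (∀ j, ∑ i, ((B i j : ℤ) - if c j = i then 1 else 0) = S j - 1) ∧
      ∀ i, (R i : ℤ) - ∑ j, ((B i j : ℤ) - if c j = i then 1 else 0) = #{j | c j = i} := by
  refine ⟨fun i j => ?_, fun j => ?_, fun i => ?_⟩
  · rcases hB.1 i j with h | h <;> by_cases hi : c j = i <;> simp [h, hi]
    subst hi
    rw [hc] at h
    omega
  · rw [← hB.2.2 j]
    simp
  · rw [← hB.2.1 i]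
    simp

theorem exists_one_in_column {m n : ℕ} {R : Fin m → ℕ} {S : Fin n → ℕ}
    (hS : ∀ j, 0 < S j) {B : Matrix (Fin m) (Fin n) ℕ} (hB : B ∈ ARS R S) (j : Fin n) :
    ∃ i, B i j = 1 := by
  by_contra! h
  have h1 := hB.2.2 j
  rw [Finset.sum_eq_zero fun i _ => (hB.1 i j).resolve_right (h i)] at h1
  exact (hS j).ne h1

/-- A matrix `A` that exceeds a binary matrix `C` by exactly one in every column has `t`-term
rank at least the sum of the excesses of its rows truncated at `t`. -/
theorem sum_min_le_tTermRank {m n : ℕ} (A : Matrix (Fin m) (Fin n) ℕ) (C : Fin m → Fin n → ℤ)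
    (hA : IsZeroOne A) (hC : IsBinary C) (hle : ∀ i j, C i j ≤ A i j)
    (hcol : ∀ j, ∑ i, ((A i j : ℤ) - C i j) = 1) (t : ℕ) :
    ∑ i, min (∑ j, ((A i j : ℤ) - C i j)) t ≤ tTermRank t A := by
  have hcard : ∀ i, ∑ j, ((A i j : ℤ) - C i j) = #{j | (A i j : ℤ) - C i j = 1} := by
    intro i
    rw [Finset.card_filter]
    push_cast
    refine Finset.sum_congr rfl fun j _ => ?_
    have h1 := hA i j
    have h2 := hC i j
    have h3 := hle i j
    split_ifs <;> omega
  have hex : ∀ i, ∃ s ⊆ ({j | (A i j : ℤ) - C i j = 1} : Finset (Fin n)),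
      #s = min #{j | (A i j : ℤ) - C i j = 1} t :=
    fun i => Finset.exists_subset_card_eq (min_le_left _ _)
  choose s hs hs' using hex
  have hmem : ∀ i, ∀ j ∈ s i, (A i j : ℤ) - C i j = 1 := fun i j hj => by
    simpa using hs i hj
  have hrowcard : ∀ i, #{p ∈ ({p | p.2 ∈ s p.1} : Finset (Fin m × Fin n)) | p.1 = i} = #(s i) := by
    intro i
    refine Finset.card_nbij Prod.snd ?_ ?_ ?_
    · rintro ⟨a, b⟩ h
      simp at h
      obtain ⟨h, rfl⟩ := h
      exact h
    · rintro ⟨a, b⟩ h ⟨a', b'⟩ h' hb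
      simp at h h' hb
      simp [h.2, h'.2, hb]
    · intro b hb
      exact ⟨(i, b), by simpa using hb, rfl⟩
  have hP : ({p | p.2 ∈ s p.1} : Finset (Fin m × Fin n)).card ≤ tTermRank t A := by
    unfold tTermRank
    refine Finset.le_sup (f := Finset.card) ?_
    simp only [Finset.mem_filter, Finset.mem_powerset, Finset.subset_univ, true_and,
      Finset.mem_univ]
    refine ⟨fun p hp => ?_, fun j => ?_, fun i => ?_⟩
    · have h1 := hmem _ _ hp
      have h2 := hA p.1 p.2
      have h3 := hC p.1 p.2
      omega
    · rw [Finset.card_le_one]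
      rintro ⟨a, b⟩ h ⟨a', b'⟩ h'
      simp at h h'
      obtain ⟨h, rfl⟩ := h
      obtain ⟨h', rfl⟩ := h'
      by_contra hne
      have hne' : a ≠ a' := fun h => hne (by rw [h])
      have h1 := Finset.sum_le_sum_of_subset_of_nonneg (Finset.subset_univ {a, a'})
        (f := fun i => (A i b' : ℤ) - C i b') (fun i _ _ => by have := hle i b'; omega)
      rw [hcol, Finset.sum_pair hne', hmem _ _ h, hmem _ _ h'] at h1
      omega
    · rw [hrowcard, hs']
      exact min_le_right _ _
  rw [Finset.card_eq_sum_card_fiberwise (f := Prod.fst) (t := Finset.univ) (by simp)] at hP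
  simp only [hrowcard, hs'] at hP
  simp only [hcard]
  exact_mod_cast hP

/-- In any nonempty class `𝒜(R,S)` there is a single matrix realizing all the
maximum `t`-term ranks for every positive integer `t`. -/
theorem exists_matrix_realizing_all_max_tTermRanks {m n : ℕ}
    (R : Fin m → ℕ) (S : Fin n → ℕ)
    (hRS : IsPartitionPair R S) (hne : (ARS R S).Nonempty) :
    ∃ A ∈ ARS R S, ∀ t : ℕ, 0 < t →
      tTermRank t A = sSup {r : ℕ | ∃ B ∈ ARS R S, tTermRank t B = r} := by
  have hS := hRS.2.2.2.1
  obtain ⟨B₀, hB₀⟩ := hne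
  obtain ⟨C, ⟨hC, hCT, hCR⟩, hmax⟩ := exists_slack_maximizing_all_truncated_sums
    (fun i => (R i : ℤ)) (fun j => (S j : ℤ) - 1) (by
      choose c hc using exists_one_in_column hS hB₀
      obtain ⟨h1, h2, h3⟩ := isBinary_sub_column_choice hB₀ hc
      exact ⟨_, h1, h2, fun i => by have := h3 i; omega⟩)
  have hBr : ∀ i, ∑ j, (B₀ i j : ℤ) = R i := fun i => by exact_mod_cast hB₀.2.1 i
  have hBc : ∀ j, ∑ i, (B₀ i j : ℤ) = S j := fun j => by exact_mod_cast hB₀.2.2 j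
  obtain ⟨A', C', hA', hC', hAr, hAc, hCr, hCc, hle⟩ := exists_nested_of_sub_colSum_eq_one
    (fun i j => (B₀ i j : ℤ)) C (fun i j => by simpa using hB₀.1 i j) hC
    (fun j => by rw [hBc, hCT]; ring) (fun i => by rw [hBr]; exact hCR i)
  obtain ⟨A, rfl⟩ : ∃ A : Matrix (Fin m) (Fin n) ℕ, A' = fun i j => (A i j : ℤ) :=
    ⟨fun i j => (A' i j).toNat, by
      funext i j
      have := hA' i j
      dsimp only
      omega⟩
  simp only [hBr, hBc] at hAr hAc
  have hA : A ∈ ARS R S := ⟨fun i j => by simpa using hA' i j,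
    fun i => by exact_mod_cast hAr i, fun j => by exact_mod_cast hAc j⟩
  refine ⟨A, hA, fun t _ => Eq.symm (IsGreatest.csSup_eq (And.intro ⟨A, hA, rfl⟩ ?_))⟩
  rintro _ ⟨B, hB, rfl⟩
  have hlow := sum_min_le_tTermRank A C' hA.1 hC' hle
    (fun j => by rw [Finset.sum_sub_distrib, hAc, hCc, hCT]; ring) t
  simp only [Finset.sum_sub_distrib, hAr, hCr] at hlow
  refine Finset.sup_le fun P hP => ?_
  simp only [Finset.mem_filter, Finset.mem_powerset, Finset.subset_univ, true_and] at hP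
  obtain ⟨h1, h2, h3⟩ := hP
  obtain ⟨c, hc, hcP⟩ := exists_column_choice (exists_one_in_column hS hB) h1 h2
  obtain ⟨hD, hDT, hDr⟩ := isBinary_sub_column_choice hB hc
  have hup := hmax _ hD hDT t
  simp only [hDr] at hup
  have hPcard : P.card ≤ ∑ i, min #{j | c j = i} t := by
    rw [Finset.card_eq_sum_card_fiberwise (f := Prod.fst) (t := Finset.univ) (by simp)]
    refine Finset.sum_le_sum fun i _ => le_min ?_ (h3 i)
    refine Finset.card_le_card_of_injOn Prod.snd ?_ ?_
    · intro p hp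
      simp at hp
      simp [hcP p hp.1, hp.2]
    · intro p hp q hq hpq
      simp at hp hq
      exact Prod.ext (hp.2.trans hq.2.symm) hpq
  have hPcard' : (P.card : ℤ) ≤ ∑ i, min (#{j | c j = i} : ℤ) t := by exact_mod_cast hPcard
  exact_mod_cast hPcard'.trans (hup.trans hlow)
end
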